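/- With 0/1 utilities and k agents, the price of anarchy of the Balanced Like mechanism from an egalitarian perspective is at least k: for every k ≥ 1, in the instance with k agents and k² items where agent 1 has utility 1 for the first k items and 0 for all remaining items, and every other agent has utility 1 for all k² items, sincere bidding is a pure Nash equilibrium of the Balanced Like mechanism, some allocation has egalitarian welfare k, and the ex ante egalitarian welfare of the Balanced Like mechanism under sincere bidding is 1. -/

import Mathlib

open Finset

/-- The set of agents bidding for an item with bid vector `bid`. -/
def bidders {k : ℕ} (bid : Fin k → Bool) : Finset (Fin k) :=
  Finset.univ.filter (fun i => bid i = true)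

/-- The number of items among those arriving strictly before item `j`
that allocation `A` gives to agent `i`. -/
def countsBefore {k m : ℕ} (A : Fin m → Option (Fin k)) (j : Fin m) (i : Fin k) : ℕ :=
  (Finset.univ.filter (fun j' : Fin m => j' < j ∧ A j' = some i)).card

/-- Probability that the Balanced Like mechanism makes decision `a` for a single item
with bid vector `bid`, given that agent `i` currently holds `cnt i` items:
uniform among the bidders holding the fewest items, and `none` iff there is no bidder. -/
def blStep {k : ℕ} (bid : Fin k → Bool) (cnt : Fin k → ℕ) (a : Option (Fin k)) : ℚ :=
  match a with
  | none => if bidders bid = ∅ then 1 else 0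
  | some i =>
      if i ∈ (bidders bid).filter (fun i0 => ∀ i' ∈ bidders bid, cnt i0 ≤ cnt i') then
        (((bidders bid).filter (fun i0 => ∀ i' ∈ bidders bid, cnt i0 ≤ cnt i')).card : ℚ)⁻¹
      else 0

/-- Probability that the Balanced Like mechanism, with bid profile `b` and the items
arriving in the order `0, 1, …, m-1`, produces the allocation `A`. -/
def blProb {k m : ℕ} (b : Fin k → Fin m → Bool) (A : Fin m → Option (Fin k)) : ℚ :=
  ∏ j : Fin m, blStep (fun i => b i j) (countsBefore A j) (A j)

/-- Utility of agent `i` for the set of items that `A` allocates to agent `i'`. -/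
def bundleUtil {k m : ℕ} (u : Fin k → Fin m → ℚ) (A : Fin m → Option (Fin k))
    (i i' : Fin k) : ℚ :=
  ∑ j : Fin m, if A j = some i' then u i j else 0

/-- Expected utility of agent `i` under the Balanced Like mechanism with bid profile `b`. -/
def blEU {k m : ℕ} (u : Fin k → Fin m → ℚ) (b : Fin k → Fin m → Bool) (i : Fin k) : ℚ :=
  ∑ A : Fin m → Option (Fin k), blProb b A * bundleUtil u A i i

/-- The sincere bid profile: bid for exactly the items of positive utility. -/
def sincere {k m : ℕ} (u : Fin k → Fin m → ℚ) : Fin k → Fin m → Bool :=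
  fun i j => decide (0 < u i j)

/-- Number of agents bidding for item `j` under bid profile `b`. -/
def likeQ {k m : ℕ} (b : Fin k → Fin m → Bool) (j : Fin m) : ℕ :=
  (Finset.univ.filter (fun i => b i j = true)).card

/-- Expected utility of agent `i` under the Like mechanism with bid profile `b`. -/
def likeEU {k m : ℕ} (u : Fin k → Fin m → ℚ) (b : Fin k → Fin m → Bool) (i : Fin k) : ℚ :=
  ∑ j : Fin m, if b i j then u i j / (likeQ b j : ℚ) else 0

/-- Probability that the Like mechanism with bid profile `b` produces allocation `A`. -/
def likeProb {k m : ℕ} (b : Fin k → Fin m → Bool) (A : Fin m → Option (Fin k)) : ℚ :=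
  ∏ j : Fin m,
    match A j with
    | none => if bidders (fun i => b i j) = ∅ then 1 else 0
    | some i => if b i j then ((likeQ b j : ℚ))⁻¹ else 0

/-- `b` is a pure Nash equilibrium of the Like mechanism. -/
def LikePNE {k m : ℕ} (u : Fin k → Fin m → ℚ) (b : Fin k → Fin m → Bool) : Prop :=
  ∀ (i : Fin k) (b' : Fin m → Bool),
    likeEU u (Function.update b i b') i ≤ likeEU u b i

/-- `b` is a pure Nash equilibrium of the Balanced Like mechanism. -/
def BLPNE {k m : ℕ} (u : Fin k → Fin m → ℚ) (b : Fin k → Fin m → Bool) : Prop :=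
  ∀ (i : Fin k) (b' : Fin m → Bool),
    blEU u (Function.update b i b') i ≤ blEU u b i

/-- `b` is a simple pure Nash equilibrium of the Balanced Like mechanism: every unilateral
deviation either yields strictly less expected utility, or yields equal expected utility
while bidding for at least as many items. -/
def BLSimplePNE {k m : ℕ} (u : Fin k → Fin m → ℚ) (b : Fin k → Fin m → Bool) : Prop :=
  ∀ (i : Fin k) (b' : Fin m → Bool),
    blEU u (Function.update b i b') i < blEU u b i ∨
    (blEU u (Function.update b i b') i = blEU u b i ∧
      (Finset.univ.filter (fun j => b i j = true)).card ≤
        (Finset.univ.filter (fun j => b' j = true)).card)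

/-- Minimum over the (nonempty) set of agents. -/
def minAgents {k : ℕ} (hk : 0 < k) (f : Fin k → ℚ) : ℚ :=
  Finset.univ.inf' (Finset.univ_nonempty_iff.mpr (Fin.pos_iff_nonempty.mp hk)) f

/-- Egalitarian welfare of allocation `A`. -/
def egalAlloc {k m : ℕ} (hk : 0 < k) (u : Fin k → Fin m → ℚ)
    (A : Fin m → Option (Fin k)) : ℚ :=
  minAgents hk (fun i => bundleUtil u A i i)

/-- Utilitarian welfare of allocation `A`. -/
def utilAlloc {k m : ℕ} (u : Fin k → Fin m → ℚ) (A : Fin m → Option (Fin k)) : ℚ :=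
  ∑ i : Fin k, bundleUtil u A i i

/-- Expected (ex post) egalitarian welfare of the Balanced Like mechanism under bids `b`. -/
def blExpEgal {k m : ℕ} (hk : 0 < k) (u : Fin k → Fin m → ℚ)
    (b : Fin k → Fin m → Bool) : ℚ :=
  ∑ A : Fin m → Option (Fin k), blProb b A * egalAlloc hk u A

theorem blStep_nonneg {k : ℕ} (bid : Fin k → Bool) (cnt : Fin k → ℕ) (a : Option (Fin k)) :
    0 ≤ blStep bid cnt a := by
  cases a with
  | none => simp only [blStep]; split_ifs <;> norm_num
  | some i => simp only [blStep]; split_ifs <;> positivity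

theorem sum_blStep {k : ℕ} (bid : Fin k → Bool) (cnt : Fin k → ℕ) :
    ∑ a : Option (Fin k), blStep bid cnt a = 1 := by
  rw [Fintype.sum_option]
  simp only [blStep]
  rw [Finset.sum_ite_mem, Finset.univ_inter, Finset.sum_const, nsmul_eq_mul]
  rcases (bidders bid).eq_empty_or_nonempty with h | h
  · simp [h]
  · obtain ⟨i, hi, hmin⟩ := Finset.exists_min_image _ cnt h
    rw [if_neg h.ne_empty, zero_add, mul_inv_cancel₀]
    exact_mod_cast (Finset.card_pos.mpr ⟨i, Finset.mem_filter.mpr ⟨hi, hmin⟩⟩).ne'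

theorem countsBefore_snoc_castSucc {k m : ℕ} (A : Fin m → Option (Fin k)) (a : Option (Fin k))
    (j : Fin m) :
    countsBefore (Fin.snoc A a : Fin (m + 1) → Option (Fin k)) j.castSucc = countsBefore A j := by
  funext i
  simp only [countsBefore, Finset.card_filter]
  simp [-Finset.sum_boole, Fin.sum_univ_castSucc, (Fin.castSucc_lt_last j).not_gt]

theorem blProb_snoc {k m : ℕ} (b : Fin k → Fin (m + 1) → Bool) (A : Fin m → Option (Fin k))
    (a : Option (Fin k)) :
    blProb b (Fin.snoc A a : Fin (m + 1) → Option (Fin k)) =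
      blProb (fun i j => b i j.castSucc) A *
        blStep (fun i => b i (Fin.last m)) (fun i => ∑ j, if A j = some i then 1 else 0) a := by
  have h : countsBefore (Fin.snoc A a : Fin (m + 1) → Option (Fin k)) (Fin.last m) =
      fun i => ∑ j, if A j = some i then 1 else 0 := by
    funext i
    simp only [countsBefore, Finset.card_filter]
    simp [-Finset.sum_boole, Fin.sum_univ_castSucc, Fin.castSucc_lt_last]
  simp [blProb, Fin.prod_univ_castSucc, countsBefore_snoc_castSucc, h]

theorem sum_blProb {k : ℕ} : ∀ {m : ℕ} (b : Fin k → Fin m → Bool),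
    ∑ A : Fin m → Option (Fin k), blProb b A = 1
  | 0, b => by simp [blProb]
  | m + 1, b => by
    rw [← (Fin.snocEquiv fun _ : Fin (m + 1) => Option (Fin k)).sum_comp,
      Fintype.sum_prod_type_right]
    simp only [Fin.snocEquiv, Equiv.coe_fn_mk, blProb_snoc, ← Finset.mul_sum, sum_blStep, mul_one]
    exact sum_blProb _

theorem blProb_nonneg {k m : ℕ} (b : Fin k → Fin m → Bool) (A : Fin m → Option (Fin k)) :
    0 ≤ blProb b A :=
  Finset.prod_nonneg fun _ _ => blStep_nonneg _ _ _

theorem blEU_le_of_forall {k m : ℕ} {u : Fin k → Fin m → ℚ} {b : Fin k → Fin m → Bool} {i : Fin k}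
    {c : ℚ} (h : ∀ A, blProb b A ≠ 0 → bundleUtil u A i i ≤ c) : blEU u b i ≤ c := by
  calc blEU u b i ≤ ∑ A : Fin m → Option (Fin k), blProb b A * c := by
        refine Finset.sum_le_sum fun A _ => ?_
        by_cases hA : blProb b A = 0
        · simp [hA]
        · exact mul_le_mul_of_nonneg_left (h A hA) (blProb_nonneg b A)
    _ = c := by rw [← Finset.sum_mul, sum_blProb, one_mul]

theorem blEU_eq_of_forall {k m : ℕ} {u : Fin k → Fin m → ℚ} {b : Fin k → Fin m → Bool} {i : Fin k}
    {c : ℚ} (h : ∀ A, blProb b A ≠ 0 → bundleUtil u A i i = c) : blEU u b i = c := by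
  calc blEU u b i = ∑ A : Fin m → Option (Fin k), blProb b A * c := by
        refine Finset.sum_congr rfl fun A _ => ?_
        by_cases hA : blProb b A = 0
        · simp [hA]
        · rw [h A hA]
    _ = c := by rw [← Finset.sum_mul, sum_blProb, one_mul]

section Support

variable {k m : ℕ} {b : Fin k → Fin m → Bool} {A : Fin m → Option (Fin k)}

theorem blStep_ne_zero_of_blProb_ne_zero (hA : blProb b A ≠ 0) (j : Fin m) :
    blStep (fun i => b i j) (countsBefore A j) (A j) ≠ 0 :=
  Finset.prod_ne_zero_iff.mp hA j (Finset.mem_univ j)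

theorem bid_of_blProb_ne_zero (hA : blProb b A ≠ 0) {j : Fin m} {i : Fin k}
    (hj : A j = some i) : b i j = true := by
  have h := blStep_ne_zero_of_blProb_ne_zero hA j
  rw [hj] at h
  simp only [blStep, ne_eq, ite_eq_right_iff, Classical.not_imp, Finset.mem_filter] at h
  simpa [bidders] using h.1.1

theorem countsBefore_le_of_blProb_ne_zero (hA : blProb b A ≠ 0) {j : Fin m} {i i' : Fin k}
    (hj : A j = some i) (hi' : b i' j = true) :
    countsBefore A j i ≤ countsBefore A j i' := by
  have h := blStep_ne_zero_of_blProb_ne_zero hA j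
  rw [hj] at h
  simp only [blStep, ne_eq, ite_eq_right_iff, Classical.not_imp, Finset.mem_filter] at h
  exact h.1.2 i' (by simpa [bidders] using hi')

theorem exists_eq_some_of_blProb_ne_zero (hA : blProb b A ≠ 0) {j : Fin m} {i : Fin k}
    (hi : b i j = true) : ∃ i', A j = some i' := by
  have h := blStep_ne_zero_of_blProb_ne_zero hA j
  cases hj : A j with
  | some i' => exact ⟨i', rfl⟩
  | none =>
    rw [hj] at h
    have hmem : i ∈ bidders fun i => b i j := by simp [bidders, hi]
    exact absurd (if_neg (Finset.ne_empty_of_mem hmem)) h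

end Support

theorem sum_countsBefore_le {k m : ℕ} (A : Fin m → Option (Fin k)) (j : Fin m) :
    ∑ i, countsBefore A j i ≤ j := by
  classical
  unfold countsBefore
  rw [← Finset.card_biUnion]
  · calc _ ≤ (Finset.univ.filter (fun j' : Fin m => j' < j)).card := by
          refine Finset.card_le_card fun x hx => ?_
          simp only [Finset.mem_biUnion, Finset.mem_filter] at hx ⊢
          obtain ⟨_, _, h⟩ := hx
          exact ⟨h.1, h.2.1⟩
      _ = j := by rw [Finset.filter_gt_eq_Iio, Fin.card_Iio]
  · intro x _ y _ hxy
    refine Finset.disjoint_left.mpr fun l hl hl' => hxy ?_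
    simp only [Finset.mem_filter] at hl hl'
    exact Option.some_injective _ (hl.2.2.symm.trans hl'.2.2)

theorem countsBefore_pos {k m : ℕ} {A : Fin m → Option (Fin k)} {j j' : Fin m} {i : Fin k}
    (h : j' < j) (hA : A j' = some i) : 0 < countsBefore A j i :=
  Finset.card_pos.mpr ⟨j', by simp [h, hA]⟩

/-- An agent bidding for each of the first `k` items receives one of them. -/
theorem exists_lt_eq_some_of_bids {k m : ℕ} {b : Fin k → Fin m → Bool}
    {A : Fin m → Option (Fin k)} (hA : blProb b A ≠ 0) (hkm : k ≤ m) {i : Fin k}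
    (hi : ∀ j : Fin m, (j : ℕ) < k → b i j = true) : ∃ j : Fin m, (j : ℕ) < k ∧ A j = some i := by
  by_contra! hno
  choose f hf using fun j : Fin k =>
    exists_eq_some_of_blProb_ne_zero hA (hi (Fin.castLE hkm j) j.isLt)
  have key : ∀ j j' : Fin k, j' < j → f j' ≠ f j := by
    intro j j' hlt heq
    have h1 := countsBefore_le_of_blProb_ne_zero hA (hf j) (hi (Fin.castLE hkm j) j.isLt)
    have h2 : 0 < countsBefore A (Fin.castLE hkm j) (f j) :=
      countsBefore_pos (j' := Fin.castLE hkm j') hlt (heq ▸ hf j')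
    obtain ⟨l, hl⟩ := Finset.card_pos.mp (h2.trans_le h1)
    simp only [Finset.mem_filter] at hl
    exact hno l (lt_trans hl.2.1 j.isLt) hl.2.2
  have hinj : Function.Injective f := by
    intro x y hxy
    rcases lt_trichotomy x y with h | h | h
    · exact absurd hxy (key _ _ h)
    · exact h
    · exact absurd hxy.symm (key _ _ h)
  obtain ⟨j, hj⟩ := Finite.injective_iff_surjective.mp hinj i
  exact hno _ j.isLt (hj ▸ hf j)

/-- If all agents but possibly `d` bid for the first `k` items, then an agent `d` receiving one of
them holds no earlier item. -/
theorem countsBefore_eq_zero_of_lt {k m : ℕ} {b : Fin k → Fin m → Bool}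
    {A : Fin m → Option (Fin k)} (hA : blProb b A ≠ 0) {d : Fin k}
    (hb : ∀ i ≠ d, ∀ j : Fin m, (j : ℕ) < k → b i j = true) {j : Fin m} (hj : (j : ℕ) < k)
    (hd : A j = some d) : countsBefore A j d = 0 := by
  have hle : ∀ i, countsBefore A j d ≤ countsBefore A j i := fun i => by
    by_cases h : i = d
    · rw [h]
    · exact countsBefore_le_of_blProb_ne_zero hA hd (hb i h j hj)
  have h1 : k * countsBefore A j d ≤ j :=
    le_trans (by simpa using Finset.sum_le_sum fun i (_ : i ∈ Finset.univ) => hle i)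
      (sum_countsBefore_le A j)
  by_contra h
  have := Nat.le_mul_of_pos_right k (Nat.pos_of_ne_zero h)
  omega

/-- A set of items allocated to `d` has at most `N + 1` elements if each of its members arrives
when `d` holds at most `N` items. -/
theorem card_le_of_countsBefore_le {k m N : ℕ} {A : Fin m → Option (Fin k)} {d : Fin k}
    (S : Finset (Fin m)) (hS : ∀ j ∈ S, A j = some d) (hN : ∀ j ∈ S, countsBefore A j d ≤ N) :
    S.card ≤ N + 1 := by
  rcases S.eq_empty_or_nonempty with rfl | hne
  · simp
  obtain ⟨j, hj, hmax⟩ := Finset.exists_max_image S id hne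
  refine le_trans ?_ (Nat.succ_le_succ (hN j hj))
  have : S.erase j ⊆ Finset.univ.filter (fun j' : Fin m => j' < j ∧ A j' = some d) := by
    intro x hx
    obtain ⟨hxj, hxS⟩ := Finset.mem_erase.mp hx
    have hlt : x < j := lt_of_le_of_ne (hmax x hxS) hxj
    simp [hlt, hS x hxS]
  have h := Finset.card_le_card this
  rw [Finset.card_erase_of_mem hj] at h
  unfold countsBefore
  omega

/-- The utility agent `i` gets in every possible outcome of sincere bidding. -/
def sincerePayoff {k : ℕ} (i : Fin k) : ℕ :=
  if (i : ℕ) = 0 then 1 else k + 1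

theorem sum_sincerePayoff {k : ℕ} (hk : 0 < k) : ∑ i : Fin k, sincerePayoff i = k * k := by
  obtain ⟨n, rfl⟩ := Nat.exists_eq_succ_of_ne_zero hk.ne'
  simp [Fin.sum_univ_succ, sincerePayoff]
  ring

section QuadraticItems

variable {k : ℕ} {u : Fin k → Fin (k * k) → ℚ}

theorem sincere_eq_true_iff
    (hu : ∀ i j, u i j = if (i : ℕ) = 0 then (if (j : ℕ) < k then 1 else 0) else 1)
    (i : Fin k) (j : Fin (k * k)) :
    sincere u i j = true ↔ ((i : ℕ) = 0 → (j : ℕ) < k) := by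
  simp only [sincere, hu, decide_eq_true_eq]
  split_ifs <;> simp_all

theorem bundleUtil_eq_card
    (hu : ∀ i j, u i j = if (i : ℕ) = 0 then (if (j : ℕ) < k then 1 else 0) else 1)
    (A : Fin (k * k) → Option (Fin k)) (i : Fin k) :
    bundleUtil u A i i =
      (Finset.univ.filter
        (fun j : Fin (k * k) => A j = some i ∧ ((i : ℕ) = 0 → (j : ℕ) < k))).card := by
  rw [bundleUtil, Finset.card_filter, Nat.cast_sum]
  refine Finset.sum_congr rfl fun j _ => ?_
  rw [hu]
  split_ifs <;> simp_all

theorem countsBefore_le_of_deviation {b : Fin k → Fin (k * k) → Bool}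
    {A : Fin (k * k) → Option (Fin k)} (hA : blProb b A ≠ 0) {d : Fin k} (hd : (d : ℕ) ≠ 0)
    (hb : ∀ i ≠ d, ∀ j : Fin (k * k), ((i : ℕ) = 0 → (j : ℕ) < k) → b i j = true)
    {j : Fin (k * k)} (hj : A j = some d) : countsBefore A j d ≤ k := by
  by_cases hjk : (j : ℕ) < k
  · rw [countsBefore_eq_zero_of_lt hA (fun i hi j hj => hb i hi j fun _ => hj) hjk hj]
    exact Nat.zero_le k
  have hk : 0 < k := d.pos
  let z : Fin k := ⟨0, hk⟩
  have hz : z ≠ d := fun h => hd (by rw [← h])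
  obtain ⟨l, hl, hlA⟩ := exists_lt_eq_some_of_bids hA (Nat.le_mul_self k)
    (i := z) fun j hj => hb z hz j fun _ => hj
  have hpos : 0 < countsBefore A j z :=
    countsBefore_pos (Fin.lt_def.mpr (by omega)) hlA
  have hle : ∀ i ∈ Finset.univ.erase z, countsBefore A j d ≤ countsBefore A j i := by
    intro i hi
    by_cases h : i = d
    · rw [h]
    · refine countsBefore_le_of_blProb_ne_zero hA hj (hb i h j fun h0 => ?_)
      exact absurd (Fin.ext h0) (Finset.ne_of_mem_erase hi)
  have h1 := Finset.sum_le_sum hle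
  have h2 := sum_countsBefore_le A j
  rw [← Finset.add_sum_erase _ _ (Finset.mem_univ z)] at h2
  rw [Finset.sum_const, Finset.card_erase_of_mem (Finset.mem_univ z), Finset.card_univ,
    Fintype.card_fin, smul_eq_mul] at h1
  have h3 := j.isLt
  by_contra! h
  obtain ⟨n, rfl⟩ := Nat.exists_eq_succ_of_ne_zero hk.ne'
  have h4 := Nat.mul_le_mul_left n (Nat.succ_le_of_lt h)
  simp only [Nat.succ_eq_add_one, Nat.add_sub_cancel] at h1 h3 h4
  nlinarith

/-- Whatever agent `d` bids against sincere opponents, it never receives more than its sincere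
payoff. -/
theorem bundleUtil_le_sincerePayoff
    (hu : ∀ i j, u i j = if (i : ℕ) = 0 then (if (j : ℕ) < k then 1 else 0) else 1)
    {d : Fin k} {b' : Fin (k * k) → Bool} {A : Fin (k * k) → Option (Fin k)}
    (hA : blProb (Function.update (sincere u) d b') A ≠ 0) :
    bundleUtil u A d d ≤ sincerePayoff d := by
  have hb : ∀ i ≠ d, ∀ j : Fin (k * k), ((i : ℕ) = 0 → (j : ℕ) < k) →
      Function.update (sincere u) d b' i j = true := fun i hi j hj => by
    rw [Function.update_of_ne hi]
    exact (sincere_eq_true_iff hu i j).mpr hj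
  rw [bundleUtil_eq_card hu, Nat.cast_le, sincerePayoff]
  split_ifs with hd
  · refine card_le_of_countsBefore_le (d := d) (A := A) _
      (fun j hj => (Finset.mem_filter.mp hj).2.1) fun j hj => ?_
    obtain ⟨-, hjA, hjk⟩ := Finset.mem_filter.mp hj
    exact (countsBefore_eq_zero_of_lt hA (fun i hi j hj => hb i hi j fun _ => hj)
      (hjk hd) hjA).le
  · refine card_le_of_countsBefore_le (d := d) (A := A) _
      (fun j hj => (Finset.mem_filter.mp hj).2.1) fun j hj => ?_
    exact countsBefore_le_of_deviation hA hd hb (Finset.mem_filter.mp hj).2.1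

theorem sum_bundleUtil_sincere (hk : 0 < k)
    (hu : ∀ i j, u i j = if (i : ℕ) = 0 then (if (j : ℕ) < k then 1 else 0) else 1)
    {A : Fin (k * k) → Option (Fin k)} (hA : blProb (sincere u) A ≠ 0) :
    ∑ i, bundleUtil u A i i = (k * k : ℕ) := by
  simp only [bundleUtil]
  rw [Finset.sum_comm]
  have h : ∀ j : Fin (k * k), ∑ i, (if A j = some i then u i j else 0) = 1 := fun j => by
    have hlast : sincere u ⟨k - 1, by omega⟩ j = true := by
      refine (sincere_eq_true_iff hu _ _).mpr fun h0 => ?_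
      have h1 : k = 1 := by simp only at h0; omega
      subst h1
      simp
    obtain ⟨i, hi⟩ := exists_eq_some_of_blProb_ne_zero hA hlast
    have hbid := (sincere_eq_true_iff hu i j).mp (bid_of_blProb_ne_zero hA hi)
    simp only [hi, Option.some.injEq, Finset.sum_ite_eq, Finset.mem_univ, if_true, hu]
    split_ifs <;> simp_all
  simp [h]

theorem bundleUtil_sincere (hk : 0 < k)
    (hu : ∀ i j, u i j = if (i : ℕ) = 0 then (if (j : ℕ) < k then 1 else 0) else 1)
    {A : Fin (k * k) → Option (Fin k)} (hA : blProb (sincere u) A ≠ 0) (i : Fin k) :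
    bundleUtil u A i i = sincerePayoff i := by
  have hle : ∀ i ∈ Finset.univ, bundleUtil u A i i ≤ (sincerePayoff i : ℚ) := fun i _ =>
    bundleUtil_le_sincerePayoff hu (b' := sincere u i) (by rwa [Function.update_eq_self])
  refine (Finset.sum_eq_sum_iff_of_le hle).mp ?_ i (Finset.mem_univ i)
  rw [sum_bundleUtil_sincere hk hu hA, ← sum_sincerePayoff hk, Nat.cast_sum]

theorem bundleUtil_divNat
    (hu : ∀ i j, u i j = if (i : ℕ) = 0 then (if (j : ℕ) < k then 1 else 0) else 1)
    (i : Fin k) : bundleUtil u (fun j => some j.divNat) i i = k := by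
  have h : ∀ x : Fin k × Fin k, (finProdFinEquiv x).divNat = x.1 := fun x =>
    congrArg Prod.fst (finProdFinEquiv.symm_apply_apply x)
  rw [bundleUtil, ← finProdFinEquiv.sum_comp, Fintype.sum_prod_type_right]
  simp only [Option.some.injEq, h, Finset.sum_ite_eq', Finset.mem_univ, if_true]
  have h1 : ∀ y : Fin k, u i (finProdFinEquiv (i, y)) = 1 := fun y => by
    rw [hu]
    split_ifs with h0 h1
    · rfl
    · simp [finProdFinEquiv, h0] at h1
    · rfl
  simp [h1]

end QuadraticItems

/-- With 0/1 utilities and `k` agents, the egalitarian price of anarchy of the Balanced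
Like mechanism is at least `k`: with `k²` items where agent 1 likes exactly the first
`k` items and every other agent likes all items, sincere bidding is a pure Nash
equilibrium, some allocation has egalitarian welfare `k`, and the ex ante egalitarian
welfare under sincere bidding is `1`. -/
theorem balancedLike_poa_egalitarian (k : ℕ) (hk : 0 < k)
    (u : Fin k → Fin (k * k) → ℚ)
    (hu : ∀ (i : Fin k) (j : Fin (k * k)),
      u i j = if (i : ℕ) = 0 then (if (j : ℕ) < k then 1 else 0) else 1) :
    BLPNE u (sincere u) ∧
    (∃ A : Fin (k * k) → Option (Fin k), egalAlloc hk u A = k) ∧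
    minAgents hk (fun i => blEU u (sincere u) i) = 1 := by
  have hEU : ∀ i, blEU u (sincere u) i = sincerePayoff i := fun i =>
    blEU_eq_of_forall fun A hA => bundleUtil_sincere hk hu hA i
  refine ⟨fun i b' => ?_, ⟨fun j => some j.divNat, ?_⟩, ?_⟩
  · rw [hEU]
    exact blEU_le_of_forall fun A hA => bundleUtil_le_sincerePayoff hu hA
  · simp only [egalAlloc, minAgents, bundleUtil_divNat hu]
    exact Finset.inf'_const _ _
  · simp only [minAgents, hEU]
    refine le_antisymm ?_ (Finset.le_inf' _ _ fun i _ => ?_)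
    · exact (Finset.inf'_le _ (Finset.mem_univ ⟨0, hk⟩)).trans (by simp [sincerePayoff])
    · rw [sincerePayoff]
      split_ifs <;> simp
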